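/- arXiv:1710.02557 — 2 statements merged into one kernel-verified Lean document; each statement's English description precedes it below -/
import Mathlib

section
/- Let R be a semilocal ring, i.e., R/J(R) is a semisimple ring. The following are equivalent: (1) R is a UNC ring; (2) R is a nil-clean ring; (3) J(R) is nil and R/J(R) is isomorphic as a ring to a finite direct product of matrix rings over the field 𝔽₂ with two elements. -/
/-- An element is nil-clean if it is the sum of an idempotent and a nilpotent. -/
def IsNilClean {R : Type*} [Ring R] (a : R) : Prop :=
  ∃ e b : R, IsIdempotentElem e ∧ IsNilpotent b ∧ a = e + b

/-- A ring is a UNC ring if every unit is nil-clean. -/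
def IsUNCRing (R : Type*) [Ring R] : Prop :=
  ∀ u : Rˣ, IsNilClean (u : R)

/-- A nilpotent endomorphism has no nonzero submodule contained in its own image. -/
theorem Submodule.eq_bot_of_le_map_of_isNilpotent {K V : Type*} [Ring K] [AddCommGroup V]
    [Module K V] {b : Module.End K V} (hb : IsNilpotent b) {W : Submodule K V}
    (hW : W ≤ W.map b) : W = ⊥ := by
  obtain ⟨k, hk⟩ := hb
  have key : ∀ n : ℕ, W ≤ W.map (b ^ n) := by
    intro n
    induction n with
    | zero => simp [Module.End.one_eq_id]
    | succ n ih =>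
      rw [pow_succ', Module.End.mul_eq_comp, Submodule.map_comp]
      exact hW.trans (Submodule.map_mono ih)
  have := key k
  rw [hk, Submodule.map_zero] at this
  exact le_bot_iff.mp this

theorem eq_zero_of_isNilpotent_of_apply_eq_smul {D V : Type*} [DivisionRing D] [AddCommGroup V]
    [Module D V] {b : Module.End D V} (hb : IsNilpotent b) {μ : D} (hμ : μ ≠ 0) {v : V}
    (hv : b v = μ • v) : v = 0 := by
  rw [← Submodule.span_singleton_eq_bot (R := D)]
  refine Submodule.eq_bot_of_le_map_of_isNilpotent hb ?_
  rw [Submodule.span_singleton_le_iff_mem]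
  exact ⟨μ⁻¹ • v, Submodule.smul_mem _ _ (Submodule.mem_span_singleton_self v),
    by simp [hv, smul_smul, hμ]⟩

/-- The nil-clean endomorphisms of rank one are those of trace `0` or `1`. -/
theorem LinearMap.eq_zero_or_eq_one_of_isNilClean_smulRight {D V : Type*} [DivisionRing D]
    [AddCommGroup V] [Module D V] (φ : V →ₗ[D] D) (x : V)
    (h : IsNilClean (φ.smulRight x : Module.End D V)) : φ x = 0 ∨ φ x = 1 := by
  obtain ⟨e, b, he, hb, hA⟩ := h
  have hee : ∀ v, e (e v) = e v := fun v => LinearMap.congr_fun he v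
  have hbv : ∀ v, b v = φ v • x - e v := fun v => by
    rw [eq_sub_iff_add_eq', ← LinearMap.add_apply, ← hA, LinearMap.smulRight_apply]
  by_contra! hx
  obtain ⟨h0, h1⟩ := hx
  have hinj : ∀ v, φ (e v) = 0 → e v = 0 := fun v hv =>
    eq_zero_of_isNilpotent_of_apply_eq_smul hb (neg_ne_zero.mpr one_ne_zero)
      (by rw [hbv, hv, hee]; simp)
  have hx0 : x ≠ 0 := by rintro rfl; simp at h0
  obtain ⟨v, hv⟩ : ∃ v, φ (e v) ≠ 0 := by
    by_contra! hall
    exact hx0 (eq_zero_of_isNilpotent_of_apply_eq_smul hb h0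
      (by rw [hbv, hinj x (hall x), sub_zero]))
  obtain ⟨y, hey, hy⟩ : ∃ y, e y = y ∧ φ y = 1 :=
    ⟨(φ (e v))⁻¹ • e v, by rw [map_smul, hee], by rw [map_smul, smul_eq_mul, inv_mul_cancel₀ hv]⟩
  have hev : ∀ v, e v = φ (e v) • y := fun v => by
    have h2 : e (v - φ (e v) • y) = e v - φ (e v) • y := by rw [map_sub, map_smul, hey]
    rw [← sub_eq_zero, ← h2]
    exact hinj _ (by rw [h2]; simp [hy])
  have hby : b y = x - y := by rw [hbv, hy, hey, one_smul]
  have hbx : b x = φ x • x - φ (e x) • y := by rw [hbv, ← hev]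
  have hbz : b (x - y) = (φ x - 1) • (x - y) + (φ x - φ (e x)) • y := by
    rw [map_sub, hby, hbx, sub_smul, sub_smul, smul_sub, smul_sub, one_smul, one_smul]; abel
  have hz : x - y ≠ 0 := fun h => h1 (by rw [sub_eq_zero.mp h, hy])
  by_cases ht : φ x - φ (e x) = 0
  · rw [ht, zero_smul, add_zero] at hbz
    exact hz (eq_zero_of_isNilpotent_of_apply_eq_smul hb (sub_ne_zero.mpr h1) hbz)
  · have hW := Submodule.eq_bot_of_le_map_of_isNilpotent hb
      (W := Submodule.span D {y, x - y}) (by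
        have hy' : y ∈ Submodule.span D {y, x - y} := Submodule.subset_span (by simp)
        have hz' : x - y ∈ Submodule.span D {y, x - y} := Submodule.subset_span (by simp)
        rw [Submodule.span_le, Set.insert_subset_iff, Set.singleton_subset_iff]
        refine ⟨⟨(φ x - φ (e x))⁻¹ • ((x - y) - (φ x - 1) • y), ?_, ?_⟩, ⟨y, hy', hby⟩⟩
        · exact Submodule.smul_mem _ _ (Submodule.sub_mem _ hz' (Submodule.smul_mem _ _ hy'))
        · rw [map_smul, map_sub, map_smul, hby, hbz, add_sub_cancel_left, smul_smul,
            inv_mul_cancel₀ ht, one_smul])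
    rw [Submodule.span_eq_bot] at hW
    exact hz (hW _ (by simp))

theorem IsNilClean.map {R S F : Type*} [Ring R] [Ring S] [FunLike F R S] [RingHomClass F R S]
    (f : F) {a : R} (ha : IsNilClean a) : IsNilClean (f a) := by
  obtain ⟨e, b, he, hb, rfl⟩ := ha
  exact ⟨f e, f b, he.map f, hb.map f, map_add f e b⟩

theorem IsNilClean.one_sub {R : Type*} [Ring R] {a : R} (ha : IsNilClean a) :
    IsNilClean (1 - a) := by
  obtain ⟨e, b, he, hb, rfl⟩ := ha
  exact ⟨1 - e, -b, he.one_sub, hb.neg, by abel⟩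

theorem Matrix.isNilClean_vecMulLinear {n D : Type*} [Fintype n] [DecidableEq n] [Ring D]
    {A : Matrix n n D} (hA : IsNilClean A) : IsNilClean (A.vecMulLinear : Module.End D (n → D)) := by
  obtain ⟨e, b, he, ⟨k, hk⟩, rfl⟩ := hA
  have hmul : ∀ M N : Matrix n n D, (M.vecMulLinear * N.vecMulLinear : Module.End D (n → D)) =
      (N * M).vecMulLinear := fun M N => LinearMap.ext fun v => by simp
  have hpow : ∀ i, (b.vecMulLinear : Module.End D (n → D)) ^ i = (b ^ i).vecMulLinear := by
    intro i
    induction i with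
    | zero => ext; simp
    | succ i ih => rw [pow_succ', ih, hmul, pow_succ]
  refine ⟨e.vecMulLinear, b.vecMulLinear, ?_, ⟨k, ?_⟩, ?_⟩
  · rw [IsIdempotentElem, hmul, he.eq]
  · rw [hpow, hk]; exact map_zero _
  · exact map_add _ _ _

/-- A division ring having a nonempty UNC matrix ring is `𝔽₂`. -/
theorem IsUNCRing.eq_zero_or_eq_one_of_matrix {n D : Type*} [Fintype n] [DecidableEq n]
    [Nonempty n] [DivisionRing D] (h : IsUNCRing (Matrix n n D)) (a : D) : a = 0 ∨ a = 1 := by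
  obtain ⟨i⟩ := ‹Nonempty n›
  by_cases ha : a = 1
  · exact Or.inr ha
  let u : (n → D)ˣ := MulEquiv.piUnits.symm
    (Pi.mulSingle i (Units.mk0 (1 - a) (sub_ne_zero.mpr (Ne.symm ha))))
  have hu := (h (Units.map (Matrix.diagonalRingHom n D : (n → D) →* Matrix n n D) u)).one_sub
  have hA : (1 : Matrix n n D) -
      (Units.map (Matrix.diagonalRingHom n D : (n → D) →* Matrix n n D) u :) =
      Matrix.diagonal (Pi.single i a) := by
    rw [← Matrix.diagonal_one]
    change Matrix.diagonal _ - Matrix.diagonal _ = _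
    rw [Matrix.diagonal_sub]
    congr 1
    ext j
    rcases eq_or_ne j i with rfl | hj
    · simp [u]
    · simp [u, hj]
  rw [hA] at hu
  have key := Matrix.isNilClean_vecMulLinear hu
  have hr : ((Matrix.diagonal (Pi.single i a) : Matrix n n D).vecMulLinear :
      Module.End D (n → D)) =
      (LinearMap.proj (R := D) (φ := fun _ : n => D) i).smulRight (Pi.single i a) := by
    ext v j
    rcases eq_or_ne j i with rfl | hj
    · simp [Matrix.vecMul_diagonal]
    · simp [Matrix.vecMul_diagonal, hj]
  rw [hr] at key
  simpa using LinearMap.eq_zero_or_eq_one_of_isNilClean_smulRight _ _ key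

theorem nonempty_ringEquiv_zmod_two {D : Type*} [DivisionRing D]
    (h : ∀ a : D, a = 0 ∨ a = 1) : Nonempty (D ≃+* ZMod 2) := by
  have h2 : ((2 : ℕ) : D) = 0 := by
    rcases h (1 + 1) with h | h
    · push_cast; rw [← one_add_one_eq_two, h]
    · simp at h
  have : CharP D 2 := CharTwo.of_one_ne_zero_of_two_eq_zero one_ne_zero (by exact_mod_cast h2)
  refine ⟨(RingEquiv.ofBijective (ZMod.castHom (dvd_refl 2) D)
    ⟨RingHom.injective _, fun a => ?_⟩).symm⟩
  rcases h a with rfl | rfl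
  · exact ⟨0, map_zero _⟩
  · exact ⟨1, map_one _⟩

theorem IsUNCRing.of_ringEquiv {R S : Type*} [Ring R] [Ring S] (f : R ≃+* S)
    (h : IsUNCRing R) : IsUNCRing S := fun u => by
  simpa using (h (Units.map (f.symm : S →* R) u)).map f

theorem IsUNCRing.of_pi {ι : Type*} {S : ι → Type*} [∀ i, Ring (S i)]
    (h : IsUNCRing (∀ i, S i)) (i : ι) : IsUNCRing (S i) := fun u => by
  classical
  simpa using (h (MulEquiv.piUnits.symm (Pi.mulSingle i u))).map (Pi.evalRingHom S i)

theorem IsUNCRing.exists_ringEquiv_pi_matrix {S : Type*} [Ring S] [IsSemisimpleRing S]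
    (h : IsUNCRing S) : ∃ (ι : Type) (_ : Fintype ι) (d : ι → ℕ), (∀ i, 0 < d i) ∧
      Nonempty (S ≃+* ∀ i, Matrix (Fin (d i)) (Fin (d i)) (ZMod 2)) := by
  obtain ⟨n, D, d, _, hd, ⟨f⟩⟩ := IsSemisimpleRing.exists_ringEquiv_pi_matrix_divisionRing S
  have hD : ∀ i, Nonempty (D i ≃+* ZMod 2) := fun i =>
    nonempty_ringEquiv_zmod_two ((h.of_ringEquiv f).of_pi i).eq_zero_or_eq_one_of_matrix
  exact ⟨Fin n, inferInstance, d, fun i => Nat.pos_of_neZero _,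
    ⟨f.trans (RingEquiv.piCongrRight fun i => (hD i).some.mapMatrix)⟩⟩

section Ker

variable {R S : Type*} [Ring R] [Ring S] {f : R →+* S}

theorem isUnit_of_isUnit_map (hf : Function.Surjective f)
    (hJ : ∀ x, f x = 0 → IsUnit (1 + x)) {a : R} (ha : IsUnit (f a)) : IsUnit a := by
  obtain ⟨r, hr⟩ := hf ↑ha.unit⁻¹
  have h1 : IsUnit (a * r) := by
    simpa using hJ (a * r - 1) (by simp [hr])
  have h2 : IsUnit (r * a) := by
    simpa using hJ (r * a - 1) (by simp [hr])
  obtain ⟨c, hc⟩ := h1.exists_right_inv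
  obtain ⟨d, hd⟩ := h2.exists_left_inv
  exact isUnit_iff_exists_and_exists.mpr
    ⟨⟨r * c, by rw [← mul_assoc, hc]⟩, ⟨d * r, by rw [mul_assoc, hd]⟩⟩

theorem IsUNCRing.of_surjective (hf : Function.Surjective f)
    (hJ : ∀ x, f x = 0 → IsUnit (1 + x)) (h : IsUNCRing R) : IsUNCRing S := fun u => by
  obtain ⟨a, ha⟩ := hf u
  have hu : IsUnit a := isUnit_of_isUnit_map hf hJ (ha ▸ u.isUnit)
  simpa [ha] using (h hu.unit).map f

theorem IsUNCRing.isNilpotent_of_map_eq_zero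
    (hJ : ∀ x, f x = 0 → IsUnit (1 + x)) (h : IsUNCRing R) {x : R} (hx : f x = 0) :
    IsNilpotent x := by
  obtain ⟨e, b, he, hb, hu⟩ := h (hJ x hx).unit
  rw [IsUnit.unit_spec] at hu
  have hfe : f e = 1 - f b := by
    rw [eq_sub_iff_add_eq, ← map_add, ← hu]; simp [hx]
  have hfe1 : f e = 1 :=
    (IsIdempotentElem.iff_eq_one_of_isUnit (hfe ▸ (hb.map f).isUnit_one_sub)).mp (he.map f)
  have he1 : e = 1 := (IsIdempotentElem.iff_eq_one_of_isUnit
    (by simpa using hJ (e - 1) (by simp [hfe1]))).mp he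
  rw [he1] at hu
  rwa [add_left_cancel hu]

theorem isNilClean_of_isNilClean_map (hf : Function.Surjective f)
    (hJ : ∀ x, f x = 0 → IsNilpotent x) {a : R} (ha : IsNilClean (f a)) : IsNilClean a := by
  obtain ⟨e, b, he, ⟨k, hk⟩, hab⟩ := ha
  obtain ⟨e', he', rfl⟩ := exists_isIdempotentElem_eq_of_ker_isNilpotent f hJ e (hf e) he
  refine ⟨e', a - e', he', ?_, by abel⟩
  obtain ⟨l, hl⟩ := hJ ((a - e') ^ k) (by rw [map_pow, map_sub, hab, add_sub_cancel_left, hk])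
  exact ⟨k * l, by rw [pow_mul, hl]⟩

end Ker

theorem TwoSidedIdeal.isUnit_one_add_of_mem_jacobson_bot {R : Type*} [Ring R] {x : R}
    (hx : x ∈ TwoSidedIdeal.jacobson (⊥ : TwoSidedIdeal R)) : IsUnit (1 + x) := by
  have left : ∀ y ∈ TwoSidedIdeal.jacobson (⊥ : TwoSidedIdeal R), ∃ z, z * (1 + y) = 1 := by
    intro y hy
    obtain ⟨z, hz⟩ := TwoSidedIdeal.mem_jacobson_iff.mp hy 1
    rw [TwoSidedIdeal.mem_bot, sub_eq_zero, mul_one] at hz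
    exact ⟨z, by rw [mul_add, mul_one, add_comm, hz]⟩
  obtain ⟨z, hz⟩ := left x hx
  obtain ⟨w, hw⟩ := left (-(z * x)) (TwoSidedIdeal.neg_mem _ (TwoSidedIdeal.mul_mem_left _ _ _ hx))
  have h1 : 1 + -(z * x) = z := by rw [← hz]; noncomm_ring
  rw [h1] at hw
  have h2 : w = 1 + x := left_inv_eq_right_inv hw hz
  exact isUnit_iff_exists_and_exists.mpr ⟨⟨z, h2 ▸ hw⟩, ⟨z, hz⟩⟩

section Cyclic

open Module

variable {K V : Type*} [AddCommGroup V]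

/-- If `v` is a cyclic vector of `T`, then the first `finrank K V` iterates of `v` form a basis. -/
theorem Module.End.exists_basis_pow_apply [Field K] [Module K V] [FiniteDimensional K V]
    (T : End K V) {v : V} (hv : v ≠ 0)
    (hT : ∀ W : Submodule K V, (∀ x ∈ W, T x ∈ W) → v ∈ W → W = ⊤) :
    ∃ B : Basis (Fin (finrank K V)) K V, ∀ i, B i = (T ^ (i : ℕ)) v := by
  have key : ∀ k ≤ finrank K V, LinearIndependent K (fun i : Fin k => (T ^ (i : ℕ)) v) := by
    intro k
    induction k with
    | zero => exact fun _ => linearIndependent_empty_type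
    | succ k ih =>
      intro hk
      rw [linearIndependent_finSucc']
      refine ⟨ih (by omega), fun hmem => ?_⟩
      change (T ^ k) v ∈ Submodule.span K (Set.range fun i : Fin k => (T ^ (i : ℕ)) v) at hmem
      set W := Submodule.span K (Set.range fun i : Fin k => (T ^ (i : ℕ)) v) with hW
      have hmem' : ∀ i ≤ k, (T ^ i) v ∈ W := fun i hi => by
        rcases hi.eq_or_lt with rfl | hi
        · exact hmem
        · exact Submodule.subset_span ⟨⟨i, hi⟩, rfl⟩
      have hWT : ∀ x ∈ W, T x ∈ W := by
        change W ≤ W.comap T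
        rw [hW, Submodule.span_le]
        rintro _ ⟨i, rfl⟩
        have := hmem' (i + 1) i.2
        rwa [pow_succ'] at this
      have htop := hT W hWT (by simpa using hmem' 0 (Nat.zero_le _))
      have hle := finrank_range_le_card (R := K) (fun i : Fin k => (T ^ (i : ℕ)) v)
      rw [Set.finrank, ← hW, htop, finrank_top, Fintype.card_fin] at hle
      omega
  have : Nontrivial V := ⟨v, 0, hv⟩
  have : Nonempty (Fin (finrank K V)) := ⟨⟨0, finrank_pos⟩⟩
  exact ⟨basisOfLinearIndependentOfCardEqFinrank (key _ le_rfl) (by simp), fun i => by simp⟩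

theorem Module.End.isNilpotent_of_basis_pow_apply [Field K] [Module K V] {m : ℕ}
    (B : Basis (Fin m) K V) {T b : End K V} {v : V} (hB : ∀ i, B i = (T ^ (i : ℕ)) v)
    (hT : ∀ i < m, (T ^ i) v ∈ Submodule.span K (Set.range fun j : ℕ => (b ^ j) v))
    {k : ℕ} (hk : (b ^ k) v = 0) : IsNilpotent b := by
  have htop : Submodule.span K (Set.range fun j : ℕ => (b ^ j) v) = ⊤ := by
    rw [eq_top_iff, ← B.span_eq, Submodule.span_le]
    rintro _ ⟨i, rfl⟩
    rw [hB]
    exact hT i i.2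
  refine ⟨k, LinearMap.ext_on_range htop fun j => ?_⟩
  rw [← Module.End.mul_apply, ← pow_add, add_comm, pow_add, Module.End.mul_apply, hk, map_zero,
    LinearMap.zero_apply]

theorem Module.End.coord_pow_apply [Field K] [Module K V] {m : ℕ} (B : Basis (Fin m) K V)
    {T : End K V} {v : V} (hB : ∀ i, B i = (T ^ (i : ℕ)) v) (i : ℕ) (hi : i < m) (j : Fin m) :
    B.coord j ((T ^ i) v) = if i = j then 1 else 0 := by
  have := hB ⟨i, hi⟩
  simp only at this
  rw [← this, Basis.coord_apply, Basis.repr_self, Finsupp.single_apply]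
  simp [Fin.ext_iff]

/-- A companion matrix of trace one is nil-clean. -/
theorem Module.End.isNilClean_of_coord_last_eq_one [Field K] [Module K V] {k : ℕ}
    (B : Basis (Fin (k + 1)) K V) {T : End K V} {v : V} (hB : ∀ i, B i = (T ^ (i : ℕ)) v)
    (htr : B.coord (Fin.last k) ((T ^ (k + 1)) v) = 1) : IsNilClean T := by
  set φ := B.coord (Fin.last k)
  set y := (T ^ (k + 1)) v
  have hφ : ∀ i < k + 1, φ ((T ^ i) v) = if i = k then 1 else 0 := fun i hi =>
    Module.End.coord_pow_apply B hB i hi _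
  refine ⟨φ.smulRight y, T - φ.smulRight y, ?_, ?_, by abel⟩
  · ext x
    simp [htr]
  have hb : ∀ i ≤ k, ((T - φ.smulRight y) ^ i) v = (T ^ i) v := by
    intro i
    induction i with
    | zero => simp
    | succ i ih =>
      intro hi
      rw [pow_succ', Module.End.mul_apply, ih (by omega), LinearMap.sub_apply,
        LinearMap.smulRight_apply, hφ i (by omega), if_neg (by omega), zero_smul, sub_zero,
        pow_succ', Module.End.mul_apply]
  refine Module.End.isNilpotent_of_basis_pow_apply B hB (k := k + 1) (fun i hi => ?_) ?_
  · exact Submodule.subset_span ⟨i, hb i (by omega)⟩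
  · rw [pow_succ', Module.End.mul_apply, hb k le_rfl, LinearMap.sub_apply,
      LinearMap.smulRight_apply, hφ k (by omega), if_pos rfl, one_smul, ← Module.End.mul_apply,
      ← pow_succ', sub_self]

/-- A companion matrix over `𝔽₂` of size at least three and of trace zero is nil-clean. -/
theorem Module.End.isNilClean_of_coord_last_eq_zero [Module (ZMod 2) V] {k : ℕ}
    (B : Basis (Fin (k + 3)) (ZMod 2) V) {T : End (ZMod 2) V} {v : V}
    (hB : ∀ i, B i = (T ^ (i : ℕ)) v)
    (htr : B.coord (Fin.last (k + 2)) ((T ^ (k + 3)) v) = 0) : IsNilClean T := by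
  set φ := B.coord (Fin.last (k + 2))
  set ψ := B.coord ⟨k + 1, by omega⟩ - φ with hψ'
  have hTs : ∀ i, T ((T ^ i) v) = (T ^ (i + 1)) v := fun i => by
    rw [pow_succ', Module.End.mul_apply]
  have hφ : ∀ i < k + 3, φ ((T ^ i) v) = if i = k + 2 then 1 else 0 := fun i hi =>
    Module.End.coord_pow_apply B hB i hi _
  have hψ : ∀ i < k + 3, ψ ((T ^ i) v) =
      (if i = k + 1 then 1 else 0) - if i = k + 2 then 1 else 0 := fun i hi => by
    rw [hψ', LinearMap.sub_apply, hφ i hi, Module.End.coord_pow_apply B hB i hi]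
  set γ := ψ ((T ^ (k + 3)) v)
  set p := (T ^ (k + 2)) v + (T ^ (k + 1)) v + (1 + γ) • (T ^ k) v with hp
  have hφp : φ p = 1 := by
    simp [hp, hφ]
  have hψp : ψ p = 0 := by
    simp [hp, hψ]
    decide
  have hφp' : φ (T p) = 1 := by
    simp [hp, hTs, htr, hφ]
  have hψp' : ψ (T p) = 0 := by
    simp only [hp, hTs, map_add, map_smul]
    rw [hψ (k + 2) (by omega), hψ (k + 1) (by omega)]
    change γ + _ + _ = 0
    simp only [smul_eq_mul]
    generalize γ = c
    simp only [Nat.add_left_cancel_iff, OfNat.ofNat_ne_one, if_false, if_true]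
    revert c
    decide
  set y := (T ^ (k + 2)) v - p with hy
  have hφy : φ y = 0 := by rw [hy, map_sub, hφp, hφ _ (by omega), if_pos rfl, sub_self]
  have hψy : ψ y = 1 := by
    rw [hy, map_sub, hψp, hψ _ (by omega), if_pos rfl, if_neg (by omega)]
    decide
  set e : End (ZMod 2) V := ψ.smulRight y + φ.smulRight (T p) with he
  have hex : ∀ x, e x = ψ x • y + φ x • T p := fun x => rfl
  refine ⟨e, T - e, ?_, ?_, by abel⟩
  · refine LinearMap.ext fun x => ?_
    rw [Module.End.mul_apply, hex (e x), hex x]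
    simp [hφy, hψy, hφp', hψp']
  have hb : ∀ i ≤ k + 1, ((T - e) ^ i) v = (T ^ i) v := by
    intro i
    induction i with
    | zero => simp
    | succ i ih =>
      intro hi
      rw [pow_succ', Module.End.mul_apply, ih (by omega), LinearMap.sub_apply, hex,
        hφ i (by omega), hψ i (by omega), if_neg (by omega), if_neg (by omega), sub_zero,
        zero_smul, zero_smul, add_zero, sub_zero, hTs]
  have hbp : ((T - e) ^ (k + 2)) v = p := by
    rw [pow_succ', Module.End.mul_apply, hb _ le_rfl, LinearMap.sub_apply, hex,
      hφ _ (by omega), hψ _ (by omega), if_pos rfl, if_neg (by omega), sub_zero, one_smul,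
      zero_smul, add_zero, hTs, hy, sub_sub_cancel]
  refine Module.End.isNilpotent_of_basis_pow_apply B hB (k := k + 3) (fun i hi => ?_) ?_
  · have hlow : ∀ i ≤ k + 1, (T ^ i) v ∈
        Submodule.span (ZMod 2) (Set.range fun j : ℕ => ((T - e) ^ j) v) := fun i hi =>
      Submodule.subset_span ⟨i, hb i hi⟩
    rcases Nat.lt_succ_iff.mp hi |>.eq_or_lt with rfl | hi
    · have : (T ^ (k + 2)) v = p - (T ^ (k + 1)) v - (1 + γ) • (T ^ k) v := by
        rw [hp]; abel
      rw [this]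
      exact Submodule.sub_mem _ (Submodule.sub_mem _ (Submodule.subset_span ⟨k + 2, hbp⟩)
        (hlow _ le_rfl)) (Submodule.smul_mem _ _ (hlow _ (by omega)))
    · exact hlow i (by omega)
  · rw [pow_succ', Module.End.mul_apply, hbp, LinearMap.sub_apply, hex, hφp, hψp, zero_smul,
      one_smul, zero_add, sub_self]

theorem Module.End.isNilClean_of_cyclic [Module (ZMod 2) V] [FiniteDimensional (ZMod 2) V]
    (T : End (ZMod 2) V) {v : V} (hv : v ≠ 0)
    (hT : ∀ W : Submodule (ZMod 2) V, (∀ x ∈ W, T x ∈ W) → v ∈ W → W = ⊤) : IsNilClean T := by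
  obtain ⟨B, hB⟩ := T.exists_basis_pow_apply hv hT
  have : Nontrivial V := ⟨v, 0, hv⟩
  have hpos : 0 < finrank (ZMod 2) V := finrank_pos
  generalize finrank (ZMod 2) V = m at B hB hpos
  obtain ⟨k, rfl⟩ : ∃ k, m = k + 1 := ⟨m - 1, by omega⟩
  have h01 : ∀ c : ZMod 2, c = 0 ∨ c = 1 := by decide
  rcases h01 (B.coord (Fin.last k) ((T ^ (k + 1)) v)) with h0 | h1
  swap
  · exact Module.End.isNilClean_of_coord_last_eq_one B hB h1
  match k with
  | 0 =>
    have hTv : T v = 0 := by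
      refine B.ext_elem fun i => ?_
      obtain rfl : i = Fin.last 0 := Fin.ext (by omega)
      simpa using h0
    have : T = 0 := B.ext fun i => by
      rw [hB]
      simpa using hTv
    exact ⟨0, 0, .zero, .zero, by simpa using this⟩
  | 1 =>
    obtain ⟨c, hc⟩ : ∃ c : ZMod 2, T (T v) = c • v := by
      refine ⟨B.coord 0 ((T ^ 2) v), ?_⟩
      have h := B.sum_repr ((T ^ 2) v)
      have h1 : B.repr ((T ^ 2) v) 1 = 0 := h0
      rw [Fin.sum_univ_two, h1, zero_smul, add_zero, hB] at h
      simpa [pow_two] using h.symm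
    have hcc : ∀ c : ZMod 2, c * c = c := by decide
    have hc2 : ∀ c : ZMod 2, c + c = 0 := by decide
    refine ⟨c • 1, T - c • 1, ?_, ⟨2, B.ext fun i => ?_⟩, by abel⟩
    · rw [IsIdempotentElem, smul_mul_smul_comm, hcc, one_mul]
    · have h2 : (T - c • 1) ^ 2 = T * T - (c + c) • T + (c * c) • 1 := by
        rw [pow_two, mul_smul, add_smul, sub_mul, mul_sub, mul_sub]
        simp only [mul_smul_comm, smul_mul_assoc, mul_one, one_mul]
        abel
      rw [h2, hc2, hcc, hB, zero_smul, sub_zero]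
      have hxx : ∀ x : V, c • x + c • x = 0 := fun x => by rw [← add_smul, hc2, zero_smul]
      fin_cases i
      · simp [hc, hxx]
      · simp [hc, hxx]
  | k + 2 => exact Module.End.isNilClean_of_coord_last_eq_zero B hB h0

/-- A block triangular endomorphism with nil-clean diagonal blocks is nil-clean. -/
theorem Module.End.isNilClean_of_restrict_of_mapQ [Field K] [Module K V] (T : End K V)
    (W : Submodule K V) (hW : ∀ x ∈ W, T x ∈ W)
    (h₁ : IsNilClean (T.restrict hW : End K W))
    (h₂ : IsNilClean (W.mapQ W T hW : End K (V ⧸ W))) : IsNilClean T := by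
  obtain ⟨e₁, b₁, he₁, ⟨k, hk⟩, h₁⟩ := h₁
  obtain ⟨e₂, b₂, he₂, ⟨l, hl⟩, h₂⟩ := h₂
  obtain ⟨π, hπ⟩ := W.subtype.exists_leftInverse_of_injective W.ker_subtype
  obtain ⟨s₀, hs₀⟩ := W.mkQ.exists_rightInverse_of_surjective W.range_mkQ
  have hπ : ∀ w : W, π w = w := fun w => LinearMap.congr_fun hπ w
  have hs₀ : ∀ q, W.mkQ (s₀ q) = q := fun q => LinearMap.congr_fun hs₀ q
  have hqW : ∀ w : W, W.mkQ w = 0 := fun w => by simp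
  obtain ⟨s, hs, hπs⟩ : ∃ s : (V ⧸ W) →ₗ[K] V, (∀ q, W.mkQ (s q) = q) ∧ ∀ q, π (s q) = 0 :=
    ⟨s₀ - W.subtype ∘ₗ π ∘ₗ s₀, fun q => by simp [hqW, hs₀, -Submodule.mkQ_apply],
      fun q => by simp [hπ]⟩
  have hT₁ : ∀ w : W, T w = e₁ w + b₁ w := fun w => by
    simpa using congrArg Subtype.val (LinearMap.congr_fun h₁ w)
  have hT₂ : ∀ x, W.mkQ (T x) = e₂ (W.mkQ x) + b₂ (W.mkQ x) := fun x =>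
    LinearMap.congr_fun h₂ (W.mkQ x)
  have he₁ : ∀ w, e₁ (e₁ w) = e₁ w := fun w => LinearMap.congr_fun he₁ w
  have he₂ : ∀ w, e₂ (e₂ w) = e₂ w := fun w => LinearMap.congr_fun he₂ w
  set e : End K V := W.subtype ∘ₗ e₁ ∘ₗ π + s ∘ₗ e₂ ∘ₗ W.mkQ
  have he : ∀ x, e x = e₁ (π x) + s (e₂ (W.mkQ x)) := fun x => rfl
  refine ⟨e, T - e, ?_, ⟨k + l, ?_⟩, by abel⟩
  · refine LinearMap.ext fun x => ?_
    rw [Module.End.mul_apply, he (e x), he x, map_add, map_add W.mkQ, hπ, hπs, hqW, hs, add_zero,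
      zero_add, he₁, he₂]
  have hb₁ : ∀ n, ∀ w : W, ((T - e) ^ n) w = (b₁ ^ n) w := by
    intro n
    induction n with
    | zero => simp
    | succ n ih =>
      intro w
      rw [pow_succ', Module.End.mul_apply, ih, LinearMap.sub_apply, hT₁, he, hπ, hqW, map_zero,
        map_zero, add_zero, add_sub_cancel_left, pow_succ', Module.End.mul_apply]
  have hb₂ : ∀ n x, W.mkQ (((T - e) ^ n) x) = (b₂ ^ n) (W.mkQ x) := by
    intro n
    induction n with
    | zero => simp
    | succ n ih =>
      intro x
      rw [pow_succ', Module.End.mul_apply, LinearMap.sub_apply, map_sub, hT₂, he, map_add, hqW,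
        hs, zero_add, add_sub_cancel_left, ih, pow_succ', Module.End.mul_apply]
  refine LinearMap.ext fun x => ?_
  have hmem : ((T - e) ^ l) x ∈ W := by
    have := hb₂ l x
    rwa [hl, LinearMap.zero_apply, Submodule.mkQ_apply, Submodule.Quotient.mk_eq_zero] at this
  have := hb₁ k ⟨_, hmem⟩
  rw [pow_add, Module.End.mul_apply, LinearMap.zero_apply]
  rw [hk] at this
  exact this

/-- Every endomorphism of a finite-dimensional vector space over `𝔽₂` is nil-clean. -/
theorem Module.End.isNilClean_of_zmod_two [Module (ZMod 2) V] [FiniteDimensional (ZMod 2) V]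
    (T : End (ZMod 2) V) : IsNilClean T := by
  induction hn : finrank (ZMod 2) V using Nat.strong_induction_on generalizing V with
  | _ n ih =>
    subst hn
    rcases subsingleton_or_nontrivial V with _ | _
    · exact ⟨0, 0, .zero, .zero, Subsingleton.elim _ _⟩
    obtain ⟨v, hv⟩ := exists_ne (0 : V)
    by_cases hT : ∀ W : Submodule (ZMod 2) V, (∀ x ∈ W, T x ∈ W) → v ∈ W → W = ⊤
    · exact T.isNilClean_of_cyclic hv hT
    push Not at hT
    obtain ⟨W, hW, hvW, htop⟩ := hT
    have hpos : 0 < finrank (ZMod 2) W :=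
      Submodule.one_le_finrank_iff.mpr fun h => hv (by simpa [h] using hvW)
    have hsum := W.finrank_quotient_add_finrank
    exact T.isNilClean_of_restrict_of_mapQ W hW (ih _ (Submodule.finrank_lt htop) _ rfl)
      (ih _ (by omega) _ rfl)

end Cyclic

theorem Matrix.isNilClean_of_zmod_two {n : Type*} [Fintype n] [DecidableEq n]
    (A : Matrix n n (ZMod 2)) : IsNilClean A := by
  simpa using (Module.End.isNilClean_of_zmod_two
    (LinearMap.toMatrixAlgEquiv'.symm A)).map LinearMap.toMatrixAlgEquiv'

theorem IsNilClean.pi {ι : Type*} [Finite ι] {S : ι → Type*} [∀ i, Ring (S i)] {a : ∀ i, S i}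
    (h : ∀ i, IsNilClean (a i)) : IsNilClean a := by
  cases nonempty_fintype ι
  choose e b he hb hab using h
  choose k hk using hb
  refine ⟨e, b, funext fun i => he i, ⟨∑ i, k i, funext fun i => ?_⟩, funext hab⟩
  exact pow_eq_zero_of_le (Finset.single_le_sum (fun _ _ => Nat.zero_le _) (Finset.mem_univ i))
    (hk i)

/-- For a semilocal ring `R` (i.e. `R/J(R)` is semisimple), TFAE:
(1) `R` is a UNC ring; (2) `R` is nil-clean; (3) `J(R)` is nil and `R/J(R)` is a
finite direct product of matrix rings over `𝔽₂`. -/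
theorem stmt_7 (R : Type*) [Ring R]
    (hsl : IsSemisimpleRing (TwoSidedIdeal.jacobson (⊥ : TwoSidedIdeal R)).ringCon.Quotient) :
    List.TFAE
      [IsUNCRing R,
       ∀ a : R, IsNilClean a,
       (∀ x ∈ TwoSidedIdeal.jacobson (⊥ : TwoSidedIdeal R), IsNilpotent x) ∧
         ∃ (ι : Type) (_ : Fintype ι) (d : ι → ℕ), (∀ i, 0 < d i) ∧
           Nonempty ((TwoSidedIdeal.jacobson (⊥ : TwoSidedIdeal R)).ringCon.Quotient ≃+*
             ∀ i, Matrix (Fin (d i)) (Fin (d i)) (ZMod 2))] := by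
  set J := TwoSidedIdeal.jacobson (⊥ : TwoSidedIdeal R)
  have hsurj : Function.Surjective J.ringCon.mk' := RingCon.mk'_surjective _
  have hker : ∀ x, J.ringCon.mk' x = 0 ↔ x ∈ J := fun x => by
    rw [← TwoSidedIdeal.mem_ker, TwoSidedIdeal.ker_ringCon_mk']
  have hunit : ∀ x, J.ringCon.mk' x = 0 → IsUnit (1 + x) := fun x hx =>
    TwoSidedIdeal.isUnit_one_add_of_mem_jacobson_bot ((hker x).mp hx)
  tfae_have 1 → 3 := fun h =>
    ⟨fun x hx => h.isNilpotent_of_map_eq_zero hunit ((hker x).mpr hx),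
      (h.of_surjective hsurj hunit).exists_ringEquiv_pi_matrix⟩
  tfae_have 3 → 2 := by
    rintro ⟨hJ, ι, _, d, -, ⟨f⟩⟩ a
    refine isNilClean_of_isNilClean_map hsurj (fun x hx => hJ x ((hker x).mp hx)) ?_
    simpa using (IsNilClean.pi fun i =>
      Matrix.isNilClean_of_zmod_two (f (J.ringCon.mk' a) i)).map f.symm
  tfae_have 2 → 1 := fun h u => h u
  tfae_finish
end

section
/- Let R be a nontrivial ring and G a nilpotent group. Then the group ring RG is a UNC ring if and only if R is a UNC ring and G is a 2-group. -/
theorem IsIdempotentElem.eq_one_of_isUnit {A : Type*} [Ring A] {e : A} (he : IsIdempotentElem e)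
    (hu : IsUnit e) : e = 1 :=
  hu.mul_left_cancel (by rw [he.eq, mul_one])

/-- A central unit which is nil-clean is unipotent. -/
theorem IsNilClean.isNilpotent_sub_one {A : Type*} [Ring A] {u : A} (h : IsNilClean u)
    (hu : IsUnit u) (hc : ∀ x, Commute u x) : IsNilpotent (u - 1) := by
  obtain ⟨e, b, he, hb, rfl⟩ := h
  have hbe : Commute (e + b) (-b) := (hc b).neg_right
  have hue : IsUnit (e + b + -b) := hb.neg.isUnit_add_left_of_commute hu hbe.symm
  rw [add_neg_cancel_right] at hue
  rw [he.eq_one_of_isUnit hue, add_sub_cancel_left]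
  exact hb

theorem IsUNCRing.isNilpotent_two {A : Type*} [Ring A] (h : IsUNCRing A) :
    IsNilpotent (2 : A) := by
  have := (h (-1)).isNilpotent_sub_one (Units.isUnit _) fun x ↦ by simp
  have h2 : (2 : A) = -(((-1 : Aˣ) : A) - 1) := by
    rw [Units.val_neg, Units.val_one, neg_sub, sub_neg_eq_add, one_add_one_eq_two]
  rw [h2]
  exact this.neg

theorem isNilpotent_of_map_of_ker_isNilpotent {S T : Type*} [Ring S] [Ring T] (f : S →+* T)
    (hker : ∀ x, f x = 0 → IsNilpotent x) {x : S} (hx : IsNilpotent (f x)) : IsNilpotent x := by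
  obtain ⟨n, hn⟩ := hx
  exact (hker (x ^ n) (by rw [map_pow, hn])).of_pow

theorem isUnit_of_map_of_ker_isNilpotent {S T : Type*} [Ring S] [Ring T] (f : S →+* T)
    (hf : Function.Surjective f) (hker : ∀ x, f x = 0 → IsNilpotent x) {x : S}
    (hx : IsUnit (f x)) : IsUnit x := by
  obtain ⟨v, hv⟩ := hx
  obtain ⟨y, hy⟩ := hf ↑v⁻¹
  have hone {w : S} (hw : f w = 1) : IsUnit w := by
    have := (hker (w - 1) (by rw [map_sub, hw, map_one, sub_self])).isUnit_add_one
    rwa [sub_add_cancel] at this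
  obtain ⟨c, hc⟩ := hone (w := x * y) (by rw [map_mul, hy, ← hv, Units.mul_inv])
  obtain ⟨d, hd⟩ := hone (w := y * x) (by rw [map_mul, hy, ← hv, Units.inv_mul])
  exact isUnit_iff_exists_and_exists.2
    ⟨⟨y * ↑c⁻¹, by rw [← mul_assoc, ← hc, Units.mul_inv]⟩,
      ⟨↑d⁻¹ * y, by rw [mul_assoc, ← hd, Units.inv_mul]⟩⟩

/-- The UNC property passes both ways along a surjection with nil kernel. -/
theorem isUNCRing_iff_of_surjective_of_ker_isNilpotent {S T : Type*} [Ring S] [Ring T]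
    (f : S →+* T) (hf : Function.Surjective f) (hker : ∀ x, f x = 0 → IsNilpotent x) :
    IsUNCRing S ↔ IsUNCRing T := by
  refine ⟨fun h v ↦ ?_, fun h u ↦ ?_⟩
  · obtain ⟨x, hx⟩ := hf v
    obtain ⟨u, rfl⟩ := isUnit_of_map_of_ker_isNilpotent f hf hker (hx ▸ v.isUnit)
    obtain ⟨e, b, he, hb, hu⟩ := h u
    exact ⟨f e, f b, he.map f, hb.map f, by rw [← hx, hu, map_add]⟩
  · obtain ⟨e, b, he, hb, hu⟩ := h (Units.map f u)
    obtain ⟨e', he', rfl⟩ := exists_isIdempotentElem_eq_of_ker_isNilpotent f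
      (fun x hx ↦ hker x hx) e (hf e) he
    refine ⟨e', u - e', he', isNilpotent_of_map_of_ker_isNilpotent f hker ?_,
      (add_sub_cancel _ _).symm⟩
    have : f (u - e') = b := by
      rw [map_sub, sub_eq_iff_eq_add']
      exact hu
    rwa [this]

theorem IsNilpotent.add_mul_of_central {A : Type*} [Ring A] {y c : A} (hy : IsNilpotent y)
    (hc : IsNilpotent c) (hcomm : ∀ x, Commute c x) (a : A) : IsNilpotent (y + c * a) := by
  have key (n : ℕ) : ∃ r, (y + c * a) ^ n = y ^ n + c * r := by
    induction n with
    | zero => exact ⟨0, by simp⟩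
    | succ n ih =>
      obtain ⟨r, hr⟩ := ih
      refine ⟨y ^ n * a + r * (y + c * a), ?_⟩
      rw [_root_.pow_succ, hr, add_mul, mul_add, _root_.pow_succ, mul_add c, ← mul_assoc (y ^ n),
        ← (hcomm (y ^ n)).eq]
      simp only [mul_assoc, add_assoc]
  obtain ⟨n, hn⟩ := hy
  obtain ⟨r, hr⟩ := key n
  refine IsNilpotent.of_pow (m := n) ?_
  rw [hr, hn, zero_add]
  exact (hcomm r).isNilpotent_mul_right hc

theorem exists_sub_one_pow_two_pow {A : Type*} [Ring A] (z : A) (n : ℕ) :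
    ∃ r, z ^ 2 ^ n = (z - 1) ^ 2 ^ n + 1 + 2 * r := by
  obtain ⟨r, hr⟩ := (Commute.one_right (z - 1)).exists_add_pow_prime_pow_eq Nat.prime_two n
  refine ⟨(z - 1) * r, ?_⟩
  simpa [mul_assoc] using hr

theorem isNilpotent_sub_one_of_pow_two_pow {A : Type*} [Ring A] (h2 : IsNilpotent (2 : A))
    {z : A} {n : ℕ} (hz : z ^ 2 ^ n = 1) : IsNilpotent (z - 1) := by
  obtain ⟨r, hr⟩ := exists_sub_one_pow_two_pow z n
  refine IsNilpotent.of_pow (m := 2 ^ n) ?_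
  have : (z - 1) ^ 2 ^ n = 2 * -r := by
    rw [hz] at hr
    rw [mul_neg, eq_neg_iff_add_eq_zero]
    refine add_right_cancel (b := (1 : A)) ?_
    rw [zero_add, add_right_comm, ← hr]
  rw [this]
  exact (Commute.ofNat_left 2 _).isNilpotent_mul_right h2

theorem exists_pow_two_pow_eq_one {A : Type*} [Ring A] (h2 : IsNilpotent (2 : A))
    {z : A} (hz : IsNilpotent (z - 1)) : ∃ n : ℕ, z ^ 2 ^ n = 1 := by
  obtain ⟨m, hm⟩ := hz
  obtain ⟨k, hk⟩ := h2
  have key (j : ℕ) : ∃ r, z ^ 2 ^ (m + j) = 1 + 2 ^ (j + 1) * r := by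
    induction j with
    | zero =>
      obtain ⟨r, hr⟩ := exists_sub_one_pow_two_pow z m
      exact ⟨r, by rw [add_zero, hr, pow_eq_zero_of_le Nat.lt_two_pow_self.le hm]; simp⟩
    | succ j ih =>
      obtain ⟨r, hr⟩ := ih
      refine ⟨r + 2 ^ j * r ^ 2, ?_⟩
      have hc : Commute (2 ^ (j + 1) : A) r := (Commute.ofNat_left 2 r).pow_left _
      have hsq : (2 ^ (j + 1) * r) ^ 2 = 2 ^ (j + 1 + 1) * (2 ^ j * r ^ 2) := by
        rw [hc.mul_pow, ← mul_assoc, ← pow_mul, ← pow_add]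
        congr 2
        ring
      have hdbl : 2 * (2 ^ (j + 1) * r) = 2 ^ (j + 1 + 1) * r := by
        rw [← mul_assoc, ← pow_succ']
      rw [← add_assoc, pow_succ 2, pow_mul, hr, (Commute.one_left _).add_sq, one_pow, mul_one,
        hsq, hdbl, mul_add, add_assoc]
  obtain ⟨r, hr⟩ := key k
  exact ⟨m + k, by rw [hr, pow_succ, hk]; simp⟩

namespace MonoidAlgebra

variable {R G : Type*} [Ring R] [Group G]

theorem single_one_commute_of_mem_center {z : G} (hz : z ∈ Subgroup.center G)
    (x : MonoidAlgebra R G) : Commute (single z 1) x :=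
  single_commute (fun g ↦ (Subgroup.mem_center_iff.1 hz g).symm) .one_left x

theorem isNilpotent_of_mapDomain_center_eq_zero (h2 : IsNilpotent (2 : MonoidAlgebra R G))
    (hZ : IsPGroup 2 (Subgroup.center G)) (x : MonoidAlgebra R G)
    (hx : mapDomainRingHom R (QuotientGroup.mk' (Subgroup.center G)) x = 0) :
    IsNilpotent x := by
  have key (x : MonoidAlgebra R G) : ∀ y, IsNilpotent y →
      IsNilpotent (y + (x - mapDomain Quotient.out
        (mapDomainRingHom R (QuotientGroup.mk' (Subgroup.center G)) x))) := by
    induction x using induction_linear with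
    | zero => simp
    | add a b ha hb =>
      intro y hy
      rw [map_add, mapDomain_add, add_sub_add_comm, ← add_assoc]
      exact hb _ (ha y hy)
    | single g r =>
      intro y hy
      set s : G := Quotient.out (g : G ⧸ Subgroup.center G) with hs
      have hmem : s⁻¹ * g ∈ Subgroup.center G := by
        rw [← QuotientGroup.eq, hs]
        exact Quotient.out_eq' _
      obtain ⟨n, hn⟩ := hZ ⟨_, hmem⟩
      have hn' : (s⁻¹ * g) ^ 2 ^ n = 1 := congrArg Subtype.val hn
      have hnil : IsNilpotent (single (s⁻¹ * g) (1 : R) - 1) :=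
        isNilpotent_sub_one_of_pow_two_pow h2 (n := n) (by rw [single_pow, hn', one_pow, one_def])
      have hcomm (a : MonoidAlgebra R G) : Commute (single (s⁻¹ * g) (1 : R) - 1) a :=
        (single_one_commute_of_mem_center hmem a).sub_left (.one_left a)
      have hmul : (single (s⁻¹ * g) (1 : R) - 1) * single s r = single g r - single s r := by
        rw [(hcomm _).eq, mul_sub, single_mul_single, mul_inv_cancel_left, mul_one, mul_one]
      have := hy.add_mul_of_central hnil hcomm (single s r)
      rw [hmul] at this
      simpa using this
  simpa [hx] using key x 0 IsNilpotent.zero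

theorem isPGroup_two_center_of_isUNCRing [Nontrivial R] (h : IsUNCRing (MonoidAlgebra R G)) :
    IsPGroup 2 (Subgroup.center G) := by
  rintro ⟨z, hz⟩
  have hu : IsUnit (single z (1 : R)) := (Group.isUnit z).map (of R G)
  obtain ⟨n, hn⟩ := exists_pow_two_pow_eq_one h.isNilpotent_two <|
    (h hu.unit).isNilpotent_sub_one hu (single_one_commute_of_mem_center hz)
  refine ⟨n, Subtype.ext ?_⟩
  rw [IsUnit.unit_spec, single_pow, one_pow, one_def] at hn
  exact single_left_injective one_ne_zero hn

theorem isUNCRing_iff_of_isPGroup_two_center (h2 : IsNilpotent (2 : MonoidAlgebra R G))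
    (hZ : IsPGroup 2 (Subgroup.center G)) :
    IsUNCRing (MonoidAlgebra R G) ↔ IsUNCRing (MonoidAlgebra R (G ⧸ Subgroup.center G)) := by
  refine isUNCRing_iff_of_surjective_of_ker_isNilpotent
    (mapDomainRingHom R (QuotientGroup.mk' (Subgroup.center G))) (fun x ↦ ?_)
    (isNilpotent_of_mapDomain_center_eq_zero h2 hZ)
  induction x using induction_linear with
  | zero => exact ⟨0, map_zero _⟩
  | add a b ha hb =>
    obtain ⟨a, rfl⟩ := ha
    obtain ⟨b, rfl⟩ := hb
    exact ⟨a + b, map_add _ _ _⟩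
  | single g r =>
    obtain ⟨g, rfl⟩ := QuotientGroup.mk_surjective g
    exact ⟨single g r, by simp⟩

theorem isUNCRing_iff_of_subsingleton [Subsingleton G] :
    IsUNCRing (MonoidAlgebra R G) ↔ IsUNCRing R := by
  refine (isUNCRing_iff_of_surjective_of_ker_isNilpotent (singleOneRingHom (M := G))
    (fun x ↦ ⟨x.coeff 1, ?_⟩) fun r hr ↦ ?_).symm
  · ext g
    simp [Subsingleton.elim g 1, singleOneRingHom]
  · rw [single_right_injective (hr.trans (map_zero (singleOneRingHom (M := G))).symm)]
    exact IsNilpotent.zero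

theorem isUNCRing_iff_isPGroup_two (R : Type*) [Ring R] [Nontrivial R] (G : Type*) [Group G]
    [Group.IsNilpotent G] :
    IsUNCRing (MonoidAlgebra R G) ↔ IsUNCRing R ∧ IsPGroup 2 G := by
  refine Group.nilpotent_center_quotient_ind
    (P := fun G _ _ ↦ IsUNCRing (MonoidAlgebra R G) ↔ IsUNCRing R ∧ IsPGroup 2 G) G
    (fun G _ _ ↦ ?_) (fun G _ _ ih ↦ ?_)
  · rw [isUNCRing_iff_of_subsingleton, iff_self_and]
    exact fun _ g ↦ ⟨0, Subsingleton.elim _ _⟩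
  · refine ⟨fun h ↦ ?_, fun ⟨hR, hG⟩ ↦ ?_⟩
    · have hZ := isPGroup_two_center_of_isUNCRing h
      obtain ⟨hR, hQ⟩ :=
        ih.1 ((isUNCRing_iff_of_isPGroup_two_center h.isNilpotent_two hZ).1 h)
      refine ⟨hR, fun g ↦ ?_⟩
      obtain ⟨m, hm⟩ := hQ (g : G ⧸ Subgroup.center G)
      rw [← QuotientGroup.mk_pow, QuotientGroup.eq_one_iff] at hm
      obtain ⟨n, hn⟩ := hZ ⟨_, hm⟩
      exact ⟨m + n, by rw [pow_add, pow_mul]; exact congrArg Subtype.val hn⟩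
    · have h2 : IsNilpotent (2 : MonoidAlgebra R G) := by
        simpa only [map_ofNat] using hR.isNilpotent_two.map (singleOneRingHom (M := G))
      exact (isUNCRing_iff_of_isPGroup_two_center h2 (hG.to_subgroup _)).2
        (ih.2 ⟨hR, hG.to_quotient _⟩)

end MonoidAlgebra

/-- For a nontrivial ring `R` and a nilpotent group `G`, the group ring `RG` is
a UNC ring iff `R` is a UNC ring and `G` is a `2`-group. -/
theorem stmt_10 (R : Type*) [Ring R] [Nontrivial R] (G : Type*) [Group G]
    [Group.IsNilpotent G] :
    IsUNCRing (MonoidAlgebra R G) ↔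
      IsUNCRing R ∧ ∀ g : G, ∃ n : ℕ, orderOf g = 2 ^ n := by
  rw [MonoidAlgebra.isUNCRing_iff_isPGroup_two, IsPGroup.iff_orderOf]
end
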